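/- Let H = ℓ^2(ℕ) with canonical orthonormal basis (e_k), and let g : ℝ → ℝ be measurable with g(s) = 0 for s ≥ 0 and 0 ≤ g(s) ≤ C e^{q|s|} for s < 0, where C, q > 0. Define B̃(x) = Σ_{k≥1} (g(x_k)/k^2) e_k, where x_k = ⟨x, e_k⟩. Then: (i) the series converges in H for every x ∈ H, so B̃ : H → H is well defined; (ii) B̃ is Borel measurable and bounded on every ball of H; (iii) for every p > q there exists C' > 0 such that ⟨B̃(y+z), y⟩ ≤ C'(|y|^2 + e^{p|z|} + 1) for all y, z ∈ H. -/

import Mathlib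

open Filter
open scoped RealInnerProductSpace Topology ENNReal

noncomputable section

/-- The Hilbert space `ℓ²(ℕ)` of square-summable real sequences. -/
abbrev ellTwo : Type := lp (fun _ : ℕ => ℝ) 2

/-- The drift `B̃(x) = Σ_{k≥1} (g(x_k)/k²) e_k` (indexed over `ℕ`, so with weights
`1/(k+1)²` and the canonical orthonormal basis `e_k = lp.single 2 k 1`). -/
def Btilde (g : ℝ → ℝ) (x : ellTwo) : ellTwo :=
  ∑' k : ℕ, (g (x k) / ((k : ℝ) + 1) ^ 2) • lp.single 2 k (1 : ℝ)

lemma g_le_exp_of_abs_le {g : ℝ → ℝ} {C q : ℝ} (hC : 0 < C) (hq : 0 < q)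
    (hg0 : ∀ s : ℝ, 0 ≤ s → g s = 0)
    (hg_bound : ∀ s : ℝ, s < 0 → g s ≤ C * Real.exp (q * |s|)) {s r : ℝ} (hs : |s| ≤ r) :
    g s ≤ C * Real.exp (q * r) := by
  rcases lt_or_ge s 0 with h | h
  · refine (hg_bound s h).trans ?_
    gcongr
  · rw [hg0 s h]
    positivity

lemma g_nonneg {g : ℝ → ℝ} (hg0 : ∀ s : ℝ, 0 ≤ s → g s = 0)
    (hg_nonneg : ∀ s : ℝ, s < 0 → 0 ≤ g s) (s : ℝ) : 0 ≤ g s := by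
  rcases lt_or_ge s 0 with h | h
  · exact hg_nonneg s h
  · exact (hg0 s h).ge

lemma summable_one_div_add_one_sq : Summable fun k : ℕ => 1 / ((k : ℝ) + 1) ^ 2 := by
  have h := (summable_nat_add_iff 1).2 (Real.summable_one_div_nat_pow.2 one_lt_two)
  simpa using h

lemma abs_coord_le_norm (x : ellTwo) (k : ℕ) : |x k| ≤ ‖x‖ := by
  simpa using lp.norm_apply_le_norm (p := 2) (by norm_num) x k

lemma norm_term_le {g : ℝ → ℝ} {C q : ℝ} (hC : 0 < C) (hq : 0 < q)
    (hg0 : ∀ s : ℝ, 0 ≤ s → g s = 0)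
    (hg_nonneg : ∀ s : ℝ, s < 0 → 0 ≤ g s)
    (hg_bound : ∀ s : ℝ, s < 0 → g s ≤ C * Real.exp (q * |s|)) {x : ellTwo} {r : ℝ}
    (hx : ‖x‖ ≤ r) (k : ℕ) :
    ‖((g (x k) / ((k : ℝ) + 1) ^ 2) • lp.single 2 k (1 : ℝ) : ellTwo)‖
      ≤ C * Real.exp (q * r) * (1 / ((k : ℝ) + 1) ^ 2) := by
  have hg := g_nonneg hg0 hg_nonneg (x k)
  have hgr := g_le_exp_of_abs_le hC hq hg0 hg_bound ((abs_coord_le_norm x k).trans hx)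
  rw [norm_smul, lp.norm_single (by norm_num), norm_one, mul_one,
    Real.norm_of_nonneg (by positivity), div_eq_mul_one_div]
  gcongr

lemma mul_le_of_pos_shift {g : ℝ → ℝ} {C q : ℝ} (hC : 0 < C) (hq : 0 < q)
    (hg0 : ∀ s : ℝ, 0 ≤ s → g s = 0)
    (hg_nonneg : ∀ s : ℝ, s < 0 → 0 ≤ g s)
    (hg_bound : ∀ s : ℝ, s < 0 → g s ≤ C * Real.exp (q * |s|)) {a b r : ℝ} (hb : |b| ≤ r) :
    g (a + b) * a ≤ C * Real.exp (q * r) * r := by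
  have hr : 0 ≤ r := (abs_nonneg b).trans hb
  have hg := g_nonneg hg0 hg_nonneg (a + b)
  have hR : 0 ≤ C * Real.exp (q * r) * r := by positivity
  rcases le_or_gt a 0 with ha | ha
  · exact (mul_nonpos_of_nonneg_of_nonpos hg ha).trans hR
  rcases lt_or_ge (a + b) 0 with h | h
  · have hbr := (abs_le.1 hb).1
    have hab : |a + b| ≤ r := abs_le.2 ⟨by linarith, by linarith⟩
    have har : a ≤ r := by linarith
    have := g_le_exp_of_abs_le hC hq hg0 hg_bound hab
    gcongr
  · rw [hg0 _ h, zero_mul]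
    exact hR

lemma measurable_Btilde {g : ℝ → ℝ} (hgm : Measurable g)
    (hs : ∀ x : ellTwo, Summable fun k : ℕ =>
      ((g (x k) / ((k : ℝ) + 1) ^ 2) • lp.single 2 k (1 : ℝ) : ellTwo)) :
    @Measurable ellTwo ellTwo (borel ellTwo) (borel ellTwo) (Btilde g) := by
  let _ : MeasurableSpace ellTwo := borel ellTwo
  have _ : BorelSpace ellTwo := ⟨rfl⟩
  have hlim : Tendsto (fun n (x : ellTwo) => ∑ k ∈ Finset.range n,
      ((g (x k) / ((k : ℝ) + 1) ^ 2) • lp.single 2 k (1 : ℝ) : ellTwo)) atTop (𝓝 (Btilde g)) := by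
    rw [tendsto_pi_nhds]
    intro x
    exact (hs x).hasSum.tendsto_sum_nat
  refine measurable_of_tendsto_metrizable (fun n => ?_) hlim
  have hcoord : Measurable fun (x : ellTwo) (k : ℕ) => g (x k) :=
    measurable_pi_lambda _ fun k => hgm.comp
      (lp.evalCLM ℝ (fun _ : ℕ => ℝ) 2 k).continuous.measurable
  have hcont : Continuous fun a : ℕ → ℝ => ∑ k ∈ Finset.range n,
      ((a k / ((k : ℝ) + 1) ^ 2) • lp.single 2 k (1 : ℝ) : ellTwo) :=
    continuous_finsetSum _ fun k _ =>
      ((continuous_apply k).div_const _).smul continuous_const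
  exact hcont.measurable.comp hcoord

/-- Example 15 of the paper. Let `g : ℝ → ℝ` be measurable with
`g(s) = 0` for `s ≥ 0` and `0 ≤ g(s) ≤ C e^{q|s|}` for `s < 0`, where `C, q > 0`. Define
`B̃(x) = Σ_k (g(x_k)/k²) e_k` on `H = ℓ²(ℕ)`. Then: (i) the defining series converges in `H`
for every `x`, so `B̃` is well defined; (ii) `B̃` is Borel measurable and bounded on every
ball of `H`; (iii) for every `p > q` there exists `C' > 0` such that
`⟨B̃(y+z), y⟩ ≤ C'(|y|² + e^{p|z|} + 1)` for all `y, z ∈ H`. -/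
theorem Btilde_admissible (g : ℝ → ℝ) (hgm : Measurable g)
    (C q : ℝ) (hC : 0 < C) (hq : 0 < q)
    (hg0 : ∀ s : ℝ, 0 ≤ s → g s = 0)
    (hg_nonneg : ∀ s : ℝ, s < 0 → 0 ≤ g s)
    (hg_bound : ∀ s : ℝ, s < 0 → g s ≤ C * Real.exp (q * |s|)) :
    -- (i)
    (∀ x : ellTwo, Summable fun k : ℕ =>
      (g (x k) / ((k : ℝ) + 1) ^ 2) • lp.single 2 k (1 : ℝ)) ∧
    -- (ii)
    (@Measurable ellTwo ellTwo (borel ellTwo) (borel ellTwo) (Btilde g) ∧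
      ∀ N : ℝ, ∃ M : ℝ, ∀ x : ellTwo, ‖x‖ ≤ N → ‖Btilde g x‖ ≤ M) ∧
    -- (iii)
    (∀ p : ℝ, q < p → ∃ C' : ℝ, 0 < C' ∧
      ∀ y z : ellTwo, ⟪Btilde g (y + z), y⟫ ≤ C' * (‖y‖ ^ 2 + Real.exp (p * ‖z‖) + 1)) := by
  have hsum : ∀ x : ellTwo, Summable fun k : ℕ =>
      ((g (x k) / ((k : ℝ) + 1) ^ 2) • lp.single 2 k (1 : ℝ) : ellTwo) := fun x =>
    Summable.of_norm_bounded (summable_one_div_add_one_sq.mul_left _)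
      (norm_term_le hC hq hg0 hg_nonneg hg_bound le_rfl)
  refine ⟨hsum, ⟨measurable_Btilde hgm hsum, fun N => ?_⟩, fun p hp => ?_⟩
  · exact ⟨_, fun x hx => tsum_of_norm_bounded (summable_one_div_add_one_sq.mul_left _).hasSum
      (norm_term_le hC hq hg0 hg_nonneg hg_bound hx)⟩
  · set S : ℝ := ∑' k : ℕ, 1 / ((k : ℝ) + 1) ^ 2
    have hS : 0 ≤ S := tsum_nonneg fun k => by positivity
    have hpq : 0 < p - q := sub_pos.2 hp
    refine ⟨C * S / (p - q) + 1, by positivity, fun y z => ?_⟩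
    have hinner : HasSum (fun k : ℕ => g ((y + z) k) * y k * (1 / ((k : ℝ) + 1) ^ 2))
        ⟪Btilde g (y + z), y⟫ := by
      have h := (hsum (y + z)).hasSum.mapL (innerSL ℝ y)
      rw [real_inner_comm]
      refine (congrArg (HasSum · _) (funext fun k => ?_)).mpr h
      rw [innerSL_apply_apply, real_inner_smul_right, lp.inner_single_right]
      simp
      ring
    have hle : ⟪Btilde g (y + z), y⟫ ≤ C * Real.exp (q * ‖z‖) * ‖z‖ * S := by
      refine hasSum_le (fun k => ?_) hinner (summable_one_div_add_one_sq.hasSum.mul_left _)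
      refine mul_le_mul_of_nonneg_right ?_ (by positivity)
      exact mul_le_of_pos_shift hC hq hg0 hg_nonneg hg_bound (abs_coord_le_norm z k)
    have hz : ‖z‖ ≤ Real.exp ((p - q) * ‖z‖) / (p - q) := by
      rw [le_div_iff₀ hpq]
      linarith [Real.add_one_le_exp ((p - q) * ‖z‖)]
    calc ⟪Btilde g (y + z), y⟫
        ≤ C * Real.exp (q * ‖z‖) * (Real.exp ((p - q) * ‖z‖) / (p - q)) * S := by
          refine hle.trans ?_
          gcongr
      _ = C * S / (p - q) * Real.exp (p * ‖z‖) := by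
          rw [show p * ‖z‖ = q * ‖z‖ + (p - q) * ‖z‖ by ring, Real.exp_add]
          ring
      _ ≤ (C * S / (p - q) + 1) * (‖y‖ ^ 2 + Real.exp (p * ‖z‖) + 1) := by
          gcongr
          · linarith
          · linarith [sq_nonneg ‖y‖]

end
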